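/- Let q > 2 and 1 < r < 2 − 2/q, and suppose both the bounded-density assumption on δ and the bounded-moment assumption with exponent q hold. Define fN_ℓ(δ) = N₀·4^ℓ·max(2^{-ℓ}, min(1, (C^{-1}·N₀^{1/2}·2^ℓ·δ)^{-r})) for constants N₀ ≥ 1 and C ≥ 1, and let N_ℓ be a random number of samples, depending on Y only through δ, satisfying fN_ℓ(δ) ≤ N_ℓ < 2·fN_ℓ(δ). Then there exists a constant c, independent of ℓ, such that Var(H(Ê_{N_ℓ}(Y)) − H(E[X|Y])) ≤ c·2^{-ℓ} for all ℓ. -/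

import Mathlib

open MeasureTheory ProbabilityTheory
open scoped ENNReal

/-- The Heaviside step function: `H(x) = 1` for `x ≥ 0` and `0` otherwise. -/
noncomputable def heaviside (x : ℝ) : ℝ := if 0 ≤ x then 1 else 0

/-- The target number of inner samples of the adaptive algorithm on level `ℓ`:
`fN_ℓ(δ) = N₀·4^ℓ·max(2^{-ℓ}, min(1, (C⁻¹·N₀^{1/2}·2^ℓ·δ)^{-r}))`, valued in `ℝ≥0∞`
so that the convention `0^{-r} = ∞` is respected when `δ = 0`. -/
noncomputable def adaptiveTarget (N₀ : ℕ) (C r : ℝ) (ℓ : ℕ) (t : ℝ) : ℝ≥0∞ :=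
  (N₀ : ℝ≥0∞) * 4 ^ ℓ *
    max ((2 : ℝ≥0∞) ^ ℓ)⁻¹
      (min 1 ((ENNReal.ofReal (C⁻¹ * (N₀ : ℝ) ^ ((1 : ℝ) / 2) * 2 ^ ℓ * t)) ^ (-r)))

/-- The constant in the second-order expansion of `|x + y| ^ q`. -/
noncomputable def rpowTaylorConst (q : ℝ) : ℝ := 2 ^ q + q + q * (q - 1) * 2 ^ q

lemma one_add_rpow_le_quadratic {q u : ℝ} (hq : 2 ≤ q) (hu : -1 < u) (hu1 : u ≤ 1) :
    (1 + u) ^ q ≤ 1 + q * u + q * (q - 1) * 2 ^ q * u ^ 2 := by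
  have tangent : ∀ p : ℝ, 1 ≤ p → (1 + u) ^ p ≤ 1 + p * u * (1 + u) ^ (p - 1) := by
    intro p hp
    have hpos : 0 < 1 + u := by linarith
    have hb := one_add_mul_self_le_rpow_one_add (s := -u / (1 + u)) (p := p)
      (by rw [le_div_iff₀ hpos]; linarith) hp
    have hinv : 1 + -u / (1 + u) = (1 + u)⁻¹ := by field_simp; ring
    rw [hinv, Real.inv_rpow hpos.le] at hb
    have hpp : 0 < (1 + u) ^ p := Real.rpow_pos_of_pos hpos p
    have hmul := mul_le_mul_of_nonneg_right hb hpp.le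
    rw [inv_mul_cancel₀ hpp.ne'] at hmul
    rw [Real.rpow_sub_one hpos.ne']
    have : (1 + p * (-u / (1 + u))) * (1 + u) ^ p
        = (1 + u) ^ p - p * u * ((1 + u) ^ p / (1 + u)) := by field_simp; ring
    linarith
  have h2q : (1 : ℝ) ≤ 2 ^ q := Real.one_le_rpow (by norm_num) (by linarith)
  have hslope : u * ((1 + u) ^ (q - 1) - 1) ≤ (q - 1) * 2 ^ q * u ^ 2 := by
    rcases le_or_gt 0 u with h0 | h0
    · have ht := tangent (q - 1) (by linarith)
      have hpow : (1 + u) ^ (q - 1 - 1) ≤ 2 ^ q :=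
        (Real.rpow_le_rpow (by linarith) (by linarith) (by linarith)).trans
          (Real.rpow_le_rpow_of_exponent_le (by norm_num : (1 : ℝ) ≤ 2) (by linarith))
      calc u * ((1 + u) ^ (q - 1) - 1) ≤ u * ((q - 1) * u * (1 + u) ^ (q - 1 - 1)) := by
            gcongr; linarith
        _ ≤ u * ((q - 1) * u * 2 ^ q) := by
            have : 0 ≤ q - 1 := by linarith
            gcongr
        _ = _ := by ring
    · have hb := one_add_mul_self_le_rpow_one_add hu.le (p := q - 1) (by linarith)
      have : 0 ≤ (q - 1) * u ^ 2 := mul_nonneg (by linarith) (sq_nonneg u)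
      nlinarith
  have ht := tangent q (by linarith)
  nlinarith [mul_le_mul_of_nonneg_left hslope (show 0 ≤ q by linarith)]

lemma abs_add_rpow_le_taylor {q : ℝ} (hq : 2 ≤ q) (x y : ℝ) :
    |x + y| ^ q ≤ |x| ^ q + q * (x * |x| ^ (q - 2) * y)
      + rpowTaylorConst q * (|x| ^ (q - 2) * y ^ 2 + |y| ^ q) := by
  have h2q : (0 : ℝ) < 2 ^ q := by positivity
  have hD : 0 ≤ q * (q - 1) * 2 ^ q :=
    mul_nonneg (mul_nonneg (by linarith) (by linarith)) h2q.le
  have hx2 : 0 ≤ |x| ^ (q - 2) := by positivity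
  have hyq : 0 ≤ |y| ^ q := by positivity
  have split_rpow : ∀ z : ℝ, |z| ^ q = |z| ^ (q - 2) * z ^ 2 := by
    intro z
    rcases eq_or_ne z 0 with rfl | hz
    · simp [Real.zero_rpow (show q ≠ 0 by linarith)]
    · rw [← sq_abs, ← Real.rpow_natCast, ← Real.rpow_add (abs_pos.mpr hz)]
      norm_num
  unfold rpowTaylorConst
  rcases le_or_gt |x| |y| with hxy | hxy
  · have h1 : |x + y| ^ q ≤ 2 ^ q * |y| ^ q := by
      rw [← Real.mul_rpow (by norm_num) (abs_nonneg y)]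
      exact Real.rpow_le_rpow (abs_nonneg _) (by linarith [abs_add_le x y]) (by linarith)
    have h2 : -(x * |x| ^ (q - 2) * y) ≤ |y| ^ q := by
      calc -(x * |x| ^ (q - 2) * y) ≤ |x * |x| ^ (q - 2) * y| := neg_le_abs _
        _ = |x| ^ (q - 2) * (|x| * |y|) := by
            rw [abs_mul, abs_mul, abs_of_nonneg hx2]; ring
        _ ≤ |y| ^ (q - 2) * (|y| * |y|) := by
            gcongr
        _ = |y| ^ q := by rw [split_rpow y, ← sq_abs]; ring
    have h3 := mul_le_mul_of_nonneg_left h2 (show 0 ≤ q by linarith)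
    have h4 : 0 ≤ |x| ^ q := by positivity
    have h5 : 0 ≤ (2 ^ q + q + q * (q - 1) * 2 ^ q) * (|x| ^ (q - 2) * y ^ 2) := by positivity
    have h6 : 0 ≤ (q * (q - 1) * 2 ^ q) * |y| ^ q := mul_nonneg hD hyq
    nlinarith
  · have hx : x ≠ 0 := by
      rintro rfl
      simp only [abs_zero] at hxy
      linarith [abs_nonneg y]
    have hu : |y / x| < 1 := by rwa [abs_div, div_lt_one (abs_pos.mpr hx)]
    obtain ⟨hu1, hu2⟩ := abs_lt.mp hu
    have hb := one_add_rpow_le_quadratic hq hu1 hu2.le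
    have hfac : |x + y| ^ q = |x| ^ (q - 2) * x ^ 2 * (1 + y / x) ^ q := by
      rw [← split_rpow, ← Real.mul_rpow (abs_nonneg x) (by linarith)]
      rw [← abs_of_pos (show 0 < 1 + y / x by linarith), ← abs_mul]
      congr 2
      field_simp
    rw [hfac, split_rpow x]
    have hmul := mul_le_mul_of_nonneg_left hb (mul_nonneg hx2 (sq_nonneg x))
    have hexp : |x| ^ (q - 2) * x ^ 2
          * (1 + q * (y / x) + q * (q - 1) * 2 ^ q * (y / x) ^ 2)
        = |x| ^ (q - 2) * x ^ 2 + q * (x * |x| ^ (q - 2) * y)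
          + q * (q - 1) * 2 ^ q * (|x| ^ (q - 2) * y ^ 2) := by
      field_simp
    have h5 : 0 ≤ (2 ^ q + q) * (|x| ^ (q - 2) * y ^ 2) := by positivity
    have h6 : 0 ≤ (2 ^ q + q + q * (q - 1) * 2 ^ q) * |y| ^ q := by positivity
    nlinarith

lemma rpow_le_one_add_rpow {x a b : ℝ} (hx : 0 ≤ x) (ha : 0 ≤ a) (hab : a ≤ b) :
    x ^ a ≤ 1 + x ^ b := by
  rcases le_or_gt x 1 with h | h
  · linarith [Real.rpow_le_one hx h ha, Real.rpow_nonneg hx b]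
  · linarith [Real.rpow_le_rpow_of_exponent_le h.le hab]

/-- A Marcinkiewicz–Zygmund type moment bound for sums of independent centred variables. -/
lemma integral_abs_sum_range_rpow_le {Ω : Type*} [MeasurableSpace Ω] {P : Measure Ω}
    [IsProbabilityMeasure P] {X : ℕ → Ω → ℝ} (hX : ∀ i, Measurable (X i))
    (hindep : iIndepFun X P) {q κ K : ℝ} (hq : 2 ≤ q)
    (hint : ∀ i, Integrable (fun ω => |X i ω| ^ q) P)
    (hmean : ∀ i, ∫ ω, X i ω ∂P = 0) (hsq : ∀ i, ∫ ω, X i ω ^ 2 ∂P ≤ 1)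
    (hκ : ∀ i, ∫ ω, |X i ω| ^ q ∂P ≤ κ)
    (hK1 : 1 ≤ K) (hK : rpowTaylorConst q * (2 + κ) ≤ K) (n : ℕ) :
    Integrable (fun ω => |∑ i ∈ Finset.range n, X i ω| ^ q) P ∧
      ∫ ω, |∑ i ∈ Finset.range n, X i ω| ^ q ∂P ≤ (K * (n + 1)) ^ (q / 2) := by
  have hκ0 : 0 ≤ κ := (integral_nonneg fun ω => by positivity).trans (hκ 0)
  have hD : 0 ≤ rpowTaylorConst q := by
    unfold rpowTaylorConst
    have : 0 ≤ q - 1 := by linarith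
    positivity
  induction n with
  | zero =>
    simp only [Finset.range_zero, Finset.sum_empty, abs_zero,
      Real.zero_rpow (show q ≠ 0 by linarith)]
    exact ⟨integrable_zero _ _ _, by simp; positivity⟩
  | succ n ih =>
    obtain ⟨hSint, hSle⟩ := ih
    set S : Ω → ℝ := fun ω => ∑ i ∈ Finset.range n, X i ω with hS
    replace hSint : Integrable (fun ω => |S ω| ^ q) P := hSint
    have hSm : Measurable S := by fun_prop
    have hSX : IndepFun S (X n) P := by
      have h := hindep.indepFun_sum_range_succ hX n
      convert h using 1
      ext ω
      simp [hS]
    have hXint : Integrable (X n) P := by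
      refine ((integrable_const 1).add (hint n)).mono' (hX n).aestronglyMeasurable
        (ae_of_all _ fun ω => ?_)
      simpa using rpow_le_one_add_rpow (abs_nonneg (X n ω)) zero_le_one (by linarith : 1 ≤ q)
    have hX2int : Integrable (fun ω => X n ω ^ 2) P := by
      refine ((integrable_const 1).add (hint n)).mono'
        ((hX n).pow_const 2).aestronglyMeasurable (ae_of_all _ fun ω => ?_)
      have h := rpow_le_one_add_rpow (abs_nonneg (X n ω)) zero_le_two hq
      simpa using h
    have hS2int : Integrable (fun ω => |S ω| ^ (q - 2)) P := by
      refine ((integrable_const 1).add hSint).mono' (Measurable.aestronglyMeasurable (by fun_prop))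
        (ae_of_all _ fun ω => ?_)
      rw [Real.norm_of_nonneg (by positivity)]
      exact rpow_le_one_add_rpow (abs_nonneg _) (by linarith) (by linarith)
    have hS1int : Integrable (fun ω => S ω * |S ω| ^ (q - 2)) P := by
      refine ((integrable_const 1).add hSint).mono' (Measurable.aestronglyMeasurable (by fun_prop))
        (ae_of_all _ fun ω => ?_)
      rw [norm_mul, Real.norm_eq_abs, Real.norm_of_nonneg (by positivity)]
      have h := rpow_le_one_add_rpow (abs_nonneg (S ω)) (by linarith : 0 ≤ 1 + (q - 2))
        (by linarith : 1 + (q - 2) ≤ q)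
      rwa [Real.rpow_add_of_nonneg (abs_nonneg _) zero_le_one (by linarith), Real.rpow_one] at h
    have hindep1 : IndepFun (fun ω => S ω * |S ω| ^ (q - 2)) (X n) P :=
      hSX.comp (φ := fun x : ℝ => x * |x| ^ (q - 2)) (ψ := id) (by fun_prop) measurable_id
    have hindep2 : IndepFun (fun ω => |S ω| ^ (q - 2)) (fun ω => X n ω ^ 2) P :=
      hSX.comp (φ := fun x : ℝ => |x| ^ (q - 2)) (ψ := fun x : ℝ => x ^ 2)
        (by fun_prop) (by fun_prop)
    have hcross1 : Integrable (fun ω => S ω * |S ω| ^ (q - 2) * X n ω) P :=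
      hindep1.integrable_mul hS1int hXint
    have hcross2 : Integrable (fun ω => |S ω| ^ (q - 2) * X n ω ^ 2) P :=
      hindep2.integrable_mul hS2int hX2int
    have hbound : ∀ ω, |∑ i ∈ Finset.range (n + 1), X i ω| ^ q ≤
        |S ω| ^ q + q * (S ω * |S ω| ^ (q - 2) * X n ω)
          + rpowTaylorConst q * (|S ω| ^ (q - 2) * X n ω ^ 2 + |X n ω| ^ q) := fun ω => by
      rw [Finset.sum_range_succ]
      exact abs_add_rpow_le_taylor hq _ _
    have hlin : Integrable (fun ω => |S ω| ^ q + q * (S ω * |S ω| ^ (q - 2) * X n ω)) P :=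
      hSint.add (hcross1.const_mul q)
    have hquad : Integrable (fun ω => |S ω| ^ (q - 2) * X n ω ^ 2 + |X n ω| ^ q) P :=
      hcross2.add (hint n)
    have hrhs : Integrable (fun ω => |S ω| ^ q + q * (S ω * |S ω| ^ (q - 2) * X n ω)
          + rpowTaylorConst q * (|S ω| ^ (q - 2) * X n ω ^ 2 + |X n ω| ^ q)) P :=
      hlin.add (hquad.const_mul _)
    have hlhs : Integrable (fun ω => |∑ i ∈ Finset.range (n + 1), X i ω| ^ q) P := by
      refine hrhs.mono' (Measurable.aestronglyMeasurable (by fun_prop))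
        (ae_of_all _ fun ω => ?_)
      rw [Real.norm_of_nonneg (by positivity)]
      exact hbound ω
    refine ⟨hlhs, ?_⟩
    set A : ℝ := K * (n + 1) with hA
    have hA1 : 1 ≤ A := by
      have : (0 : ℝ) ≤ n := n.cast_nonneg
      nlinarith
    have hA0 : 0 < A := by linarith
    have hApow : 1 ≤ A ^ (q / 2 - 1) := Real.one_le_rpow hA1 (by linarith)
    have hS2le : ∫ ω, |S ω| ^ (q - 2) ∂P ≤ 2 * A ^ (q / 2 - 1) := by
      have hpt : ∀ ω, |S ω| ^ (q - 2) ≤ A ^ (q / 2 - 1) * (1 + |S ω| ^ q / A ^ (q / 2)) := by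
        intro ω
        have h := rpow_le_one_add_rpow (x := |S ω| / A ^ (1 / 2 : ℝ)) (by positivity)
          (by linarith : 0 ≤ q - 2) (by linarith : q - 2 ≤ q)
        rw [Real.div_rpow (abs_nonneg _) (by positivity),
          Real.div_rpow (abs_nonneg _) (by positivity), ← Real.rpow_mul hA0.le,
          ← Real.rpow_mul hA0.le, div_le_iff₀ (by positivity),
          show 1 / 2 * (q - 2) = q / 2 - 1 by ring, show 1 / 2 * q = q / 2 by ring] at h
        linarith
      calc ∫ ω, |S ω| ^ (q - 2) ∂P
          ≤ ∫ ω, A ^ (q / 2 - 1) * (1 + |S ω| ^ q / A ^ (q / 2)) ∂P :=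
            integral_mono hS2int
              (((integrable_const 1).add (hSint.div_const _)).const_mul _) hpt
        _ = A ^ (q / 2 - 1) * (1 + (∫ ω, |S ω| ^ q ∂P) / A ^ (q / 2)) := by
            rw [integral_const_mul, integral_add (integrable_const 1) (hSint.div_const _),
              integral_div]
            simp
        _ ≤ A ^ (q / 2 - 1) * (1 + 1) := by
            gcongr
            exact div_le_one_of_le₀ hSle (by positivity)
        _ = _ := by ring
    have hcross1_zero : ∫ ω, S ω * |S ω| ^ (q - 2) * X n ω ∂P = 0 := by
      rw [hindep1.integral_fun_mul_eq_mul_integral hS1int.aestronglyMeasurable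
        hXint.aestronglyMeasurable, hmean, mul_zero]
    have hcross2_le : ∫ ω, |S ω| ^ (q - 2) * X n ω ^ 2 ∂P ≤ 2 * A ^ (q / 2 - 1) := by
      rw [hindep2.integral_fun_mul_eq_mul_integral hS2int.aestronglyMeasurable
        hX2int.aestronglyMeasurable]
      exact (mul_le_of_le_one_right (integral_nonneg fun ω => by positivity) (hsq n)).trans hS2le
    have hgrow : A ^ (q / 2) + K * A ^ (q / 2 - 1) ≤ (A + K) ^ (q / 2) := by
      have hb := one_add_mul_self_le_rpow_one_add (s := K / A) (p := q / 2)
        (by linarith [show 0 ≤ K / A by positivity]) (by linarith)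
      have hsplit : (A + K) ^ (q / 2) = A ^ (q / 2) * (1 + K / A) ^ (q / 2) := by
        rw [← Real.mul_rpow hA0.le (by positivity)]
        congr 1
        field_simp
      have hKA : K / A ≤ q / 2 * (K / A) :=
        le_mul_of_one_le_left (by positivity) (by linarith)
      calc A ^ (q / 2) + K * A ^ (q / 2 - 1) = A ^ (q / 2) * (1 + K / A) := by
            rw [Real.rpow_sub_one hA0.ne']; ring
        _ ≤ A ^ (q / 2) * (1 + K / A) ^ (q / 2) := by
            gcongr
            linarith
        _ = _ := hsplit.symm
    calc ∫ ω, |∑ i ∈ Finset.range (n + 1), X i ω| ^ q ∂P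
        ≤ ∫ ω, |S ω| ^ q + q * (S ω * |S ω| ^ (q - 2) * X n ω)
          + rpowTaylorConst q * (|S ω| ^ (q - 2) * X n ω ^ 2 + |X n ω| ^ q) ∂P :=
          integral_mono hlhs hrhs hbound
      _ = ∫ ω, |S ω| ^ q ∂P + q * ∫ ω, S ω * |S ω| ^ (q - 2) * X n ω ∂P
          + rpowTaylorConst q *
            (∫ ω, |S ω| ^ (q - 2) * X n ω ^ 2 ∂P + ∫ ω, |X n ω| ^ q ∂P) := by
          rw [integral_add hlin (hquad.const_mul _), integral_add hSint (hcross1.const_mul q),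
            integral_const_mul, integral_const_mul, integral_add hcross2 (hint n)]
      _ ≤ A ^ (q / 2) + q * 0 + rpowTaylorConst q * (2 * A ^ (q / 2 - 1) + κ) := by
          rw [hcross1_zero]
          gcongr
          exact hκ n
      _ ≤ A ^ (q / 2) + K * A ^ (q / 2 - 1) := by
          have h1 : κ ≤ κ * A ^ (q / 2 - 1) := le_mul_of_one_le_right hκ0 hApow
          have h2 := mul_le_mul_of_nonneg_left h1 hD
          have h3 := mul_le_mul_of_nonneg_right hK (zero_le_one.trans hApow)
          nlinarith
      _ ≤ (A + K) ^ (q / 2) := hgrow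
      _ = (K * ((n + 1 : ℕ) + 1)) ^ (q / 2) := by
          rw [hA]; push_cast; ring_nf

section Samples

variable {P : Measure (ℕ → ℝ)} {μ : Measure ℝ}

lemma map_eval_eq_of_map_fin_eq_pi [IsProbabilityMeasure μ]
    (h : ∀ n : ℕ, P.map (fun ω (i : Fin n) => ω i) = Measure.pi fun _ : Fin n => μ) (i : ℕ) :
    P.map (fun ω => ω i) = μ := by
  have hcomp : (fun ω : ℕ → ℝ => ω i)
      = (fun x : Fin (i + 1) → ℝ => x (Fin.last i)) ∘ fun ω (j : Fin (i + 1)) => ω j := by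
    ext ω; simp
  rw [hcomp, ← Measure.map_map (by fun_prop) (by fun_prop), h]
  exact (measurePreserving_eval (fun _ : Fin (i + 1) => μ) (Fin.last i)).map_eq

lemma iIndepFun_eval_of_map_fin_eq_pi [IsProbabilityMeasure P] [IsProbabilityMeasure μ]
    (h : ∀ n : ℕ, P.map (fun ω (i : Fin n) => ω i) = Measure.pi fun _ : Fin n => μ) :
    iIndepFun (fun (i : ℕ) (ω : ℕ → ℝ) => ω i) P := by
  have hfin : ∀ n : ℕ, iIndepFun (fun (i : Fin n) (ω : ℕ → ℝ) => ω i) P := by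
    intro n
    have hmeas : ∀ i : Fin n, AEMeasurable (fun ω : ℕ → ℝ => ω i) P := fun i =>
      (measurable_pi_apply (i : ℕ)).aemeasurable
    rw [iIndepFun_iff_map_fun_eq_pi_map hmeas, h n]
    congr 1
    ext1 i
    exact (map_eval_eq_of_map_fin_eq_pi h i).symm
  rw [iIndepFun_iff_finset]
  intro S
  let g : S → Fin (S.sup id + 1) := fun i => ⟨i, Nat.lt_succ_of_le (Finset.le_sup (f := id) i.2)⟩
  have hg : g.Injective := fun i j hij => Subtype.ext (Fin.mk.inj_iff.mp hij)
  exact iIndepFun.precomp (f := fun (i : Fin (S.sup id + 1)) (ω : ℕ → ℝ) => ω i) hg (hfin _)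

/-- Concentration of the sample sum at the rate given by the `q`-th central moment. -/
lemma measure_le_abs_sum_sub_le [IsProbabilityMeasure P] [IsProbabilityMeasure μ]
    (h : ∀ n : ℕ, P.map (fun ω (i : Fin n) => ω i) = Measure.pi fun _ : Fin n => μ)
    {m s q κ K : ℝ} (hm : m = ∫ x, x ∂μ) (hs : s = √(variance (fun x => x) μ)) (hs0 : 0 < s)
    (hq : 2 ≤ q) (hint : Integrable (fun x => |x - m| ^ q) μ)
    (hκ : ∫ x, |x - m| ^ q ∂μ ≤ κ * s ^ q)
    (hK1 : 1 ≤ K) (hK : rpowTaylorConst q * (2 + κ) ≤ K)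
    {n : ℕ} (hn : 1 ≤ n) {t : ℝ} (ht : 0 < t) :
    P {ω | n * (t * s) ≤ |∑ i ∈ Finset.range n, ω i - n * m|}
      ≤ ENNReal.ofReal ((2 * K) ^ (q / 2) * (n * t ^ 2) ^ (-(q / 2))) := by
  have hlaw : ∀ i : ℕ, MeasurePreserving (fun ω : ℕ → ℝ => ω i) P μ := fun i =>
    ⟨by fun_prop, map_eval_eq_of_map_fin_eq_pi h i⟩
  have hsub : Integrable (fun x => x - m) μ := by
    refine ((integrable_const 1).add hint).mono'
      (Measurable.aestronglyMeasurable (by fun_prop)) (ae_of_all _ fun x => ?_)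
    simpa using rpow_le_one_add_rpow (abs_nonneg (x - m)) zero_le_one (by linarith : 1 ≤ q)
  have hid : Integrable (fun x : ℝ => x) μ := by
    refine (hsub.add (integrable_const m)).congr (ae_of_all _ fun x => ?_)
    simp
  have hvar : ∫ x, (x - m) ^ 2 ∂μ = s ^ 2 := by
    rw [hs, Real.sq_sqrt (variance_nonneg _ _), variance_eq_integral (by fun_prop), hm]
  have hpowfun : Integrable (fun x => |(x - m) / s| ^ q) μ := by
    simp_rw [abs_div, abs_of_pos hs0, Real.div_rpow (abs_nonneg _) hs0.le]
    exact hint.div_const _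
  have transfer : ∀ (i : ℕ) (f : ℝ → ℝ), Measurable f →
      ∫ ω, f (ω i) ∂P = ∫ x, f x ∂μ := by
    intro i f hf
    rw [← (hlaw i).map_eq, integral_map (measurable_pi_apply i).aemeasurable hf.aestronglyMeasurable]
  obtain ⟨hSint, hSle⟩ := integral_abs_sum_range_rpow_le (P := P)
    (X := fun i ω => (ω i - m) / s) (fun i => by fun_prop)
    ((iIndepFun_eval_of_map_fin_eq_pi h).comp (fun _ x => (x - m) / s) (fun _ => by fun_prop))
    (q := q) (κ := κ) (K := K) hq
    (fun i => (hlaw i).integrable_comp_of_integrable hpowfun)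
    (fun i => by
      rw [transfer i (fun x => (x - m) / s) (by fun_prop), integral_div,
        integral_sub hid (integrable_const m), ← hm]
      simp)
    (fun i => by
      rw [transfer i (fun x => ((x - m) / s) ^ 2) (by fun_prop)]
      simp_rw [div_pow]
      rw [integral_div, hvar, div_self (by positivity)])
    (fun i => by
      rw [transfer i (fun x => |(x - m) / s| ^ q) (by fun_prop)]
      simp_rw [abs_div, abs_of_pos hs0, Real.div_rpow (abs_nonneg _) hs0.le]
      rw [integral_div, div_le_iff₀ (by positivity)]
      exact hκ)
    hK1 hK n
  have hn0 : (0 : ℝ) < n := by exact_mod_cast hn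
  have hn1 : (1 : ℝ) ≤ n := by exact_mod_cast hn
  have hmarkov := mul_meas_ge_le_integral_of_nonneg
    (ae_of_all P fun ω => by positivity) hSint ((n * t) ^ q)
  have hsubset : {ω : ℕ → ℝ | n * (t * s) ≤ |∑ i ∈ Finset.range n, ω i - n * m|}
      ⊆ {ω | (n * t) ^ q ≤ |∑ i ∈ Finset.range n, (ω i - m) / s| ^ q} := by
    intro ω hω
    simp only [Set.mem_ofPred_eq] at hω ⊢
    rw [← Finset.sum_div, Finset.sum_sub_distrib, Finset.sum_const, Finset.card_range,
      nsmul_eq_mul, abs_div, abs_of_pos hs0]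
    refine Real.rpow_le_rpow (by positivity) ?_ (by linarith)
    rw [le_div_iff₀ hs0]
    linarith
  have hsquare : (n * t : ℝ) ^ q = (n : ℝ) ^ (q / 2) * (n * t ^ 2) ^ (q / 2) := by
    rw [← Real.mul_rpow hn0.le (by positivity), show (n : ℝ) * (n * t ^ 2) = (n * t) ^ 2 by ring,
      ← Real.rpow_natCast, ← Real.rpow_mul (by positivity)]
    congr 1
    push_cast
    ring
  refine (measure_mono hsubset).trans ?_
  rw [← ofReal_measureReal]
  refine ENNReal.ofReal_le_ofReal ?_
  have hnK : (K * (n + 1)) ^ (q / 2) ≤ (2 * K) ^ (q / 2) * (n : ℝ) ^ (q / 2) := by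
    rw [← Real.mul_rpow (by positivity) hn0.le]
    exact Real.rpow_le_rpow (by positivity) (by nlinarith) (by linarith)
  have hle := hmarkov.trans (hSle.trans hnK)
  rw [hsquare, mul_comm ((2 * K) ^ (q / 2)), mul_assoc] at hle
  have hle' := le_of_mul_le_mul_left hle (by positivity)
  rw [hsquare, Real.rpow_neg (by positivity), ← div_eq_mul_inv, le_div_iff₀ (by positivity)]
  linarith

end Samples

section Target

variable {N₀ : ℕ} {C r : ℝ} {ℓ n : ℕ} {t : ℝ}

lemma two_pow_le_of_adaptiveTarget_le (hN₀ : 1 ≤ N₀) (h : adaptiveTarget N₀ C r ℓ t ≤ n) :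
    (2 : ℝ) ^ ℓ ≤ n := by
  have hle : ((2 : ℝ≥0∞) ^ ℓ) ≤ n := by
    refine le_trans ?_ h
    unfold adaptiveTarget
    calc ((2 : ℝ≥0∞) ^ ℓ) = 1 * 4 ^ ℓ * (2 ^ ℓ)⁻¹ := by
          rw [show (4 : ℝ≥0∞) = 2 * 2 by norm_num, mul_pow, one_mul, mul_assoc,
            ENNReal.mul_inv_cancel (by simp) (by simp), mul_one]
      _ ≤ _ := by
          gcongr
          · exact_mod_cast hN₀
          · exact le_max_left _ _
  exact_mod_cast hle

/-- The distance from the discontinuity below which the maximal number of samples is used. -/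
noncomputable def adaptiveScale (N₀ : ℕ) (C : ℝ) (ℓ : ℕ) : ℝ :=
  C / (N₀ : ℝ) ^ ((1 : ℝ) / 2) * ((2 : ℝ) ^ ℓ)⁻¹

lemma adaptiveScale_pos (hN₀ : 1 ≤ N₀) (hC : 1 ≤ C) : 0 < adaptiveScale N₀ C ℓ := by
  have : (0 : ℝ) < N₀ := by exact_mod_cast hN₀
  unfold adaptiveScale
  positivity

lemma rpow_le_of_adaptiveTarget_le (hN₀ : 1 ≤ N₀) (hC : 1 ≤ C) (hr : 0 ≤ r)
    (ht : adaptiveScale N₀ C ℓ < t) (h : adaptiveTarget N₀ C r ℓ t ≤ n) :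
    (t / adaptiveScale N₀ C ℓ) ^ (2 - r) ≤ n * t ^ 2 := by
  have hN0 : (0 : ℝ) < N₀ := by exact_mod_cast hN₀
  have hscale := adaptiveScale_pos (ℓ := ℓ) hN₀ hC
  have ht0 : 0 < t := hscale.trans ht
  set a := t / adaptiveScale N₀ C ℓ with ha
  have ha1 : 1 < a := (one_lt_div hscale).mpr ht
  have ha0 : 0 < a := by linarith
  have hsqrt : ((N₀ : ℝ) ^ ((1 : ℝ) / 2)) ^ 2 = N₀ := by
    rw [← Real.rpow_natCast, ← Real.rpow_mul hN0.le]; norm_num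
  have hroot : (0 : ℝ) < (N₀ : ℝ) ^ ((1 : ℝ) / 2) := by positivity
  have ha_eq : C⁻¹ * (N₀ : ℝ) ^ ((1 : ℝ) / 2) * 2 ^ ℓ * t = a := by
    rw [ha, adaptiveScale]
    field_simp
  have hn : (N₀ : ℝ) * 4 ^ ℓ * a ^ (-r) ≤ n := by
    have hle : ENNReal.ofReal ((N₀ : ℝ) * 4 ^ ℓ * a ^ (-r)) ≤ n := by
      refine le_trans ?_ h
      unfold adaptiveTarget
      rw [ha_eq, ENNReal.ofReal_rpow_of_pos ha0, ENNReal.ofReal_mul (by positivity),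
        ENNReal.ofReal_mul (by positivity), ENNReal.ofReal_natCast,
        ENNReal.ofReal_pow (by norm_num), min_eq_right]
      · gcongr
        · simp
        · exact le_max_right _ _
      · rw [← ENNReal.ofReal_one]
        exact ENNReal.ofReal_le_ofReal (Real.rpow_le_one_of_one_le_of_nonpos ha1.le (by linarith))
    rw [← ENNReal.ofReal_natCast] at hle
    exact (ENNReal.ofReal_le_ofReal_iff n.cast_nonneg).mp hle
  have ht_eq : (N₀ : ℝ) * 4 ^ ℓ * t ^ 2 = C ^ 2 * a ^ 2 := by
    rw [← ha_eq, mul_pow, mul_pow, mul_pow, hsqrt, ← pow_mul, mul_comm ℓ 2, pow_mul]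
    field_simp
    norm_num
  have hpow : a ^ (2 - r) = a ^ 2 * a ^ (-r) := by
    rw [sub_eq_add_neg, Real.rpow_add ha0]; norm_num
  have hC2 : 1 ≤ C ^ 2 := one_le_pow₀ hC
  calc a ^ (2 - r) ≤ C ^ 2 * a ^ (2 - r) := le_mul_of_one_le_left (by positivity) hC2
    _ = (N₀ : ℝ) * 4 ^ ℓ * a ^ (-r) * t ^ 2 := by
        rw [hpow, ← mul_assoc, ← ht_eq]; ring
    _ ≤ n * t ^ 2 := by gcongr

end Target

section Envelope

/-- An upper envelope for the conditional error probability at distance `t` from the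
discontinuity: trivial below the scale `h`, algebraically decaying up to `δ₀`, constant beyond. -/
noncomputable def errorEnvelope (δ₀ h b A B : ℝ) (t : ℝ) : ℝ≥0∞ :=
  (Set.Icc 0 δ₀ ∩ Set.Iic h).indicator 1 t
    + (Set.Icc 0 δ₀ ∩ Set.Ioi h).indicator (fun t => ENNReal.ofReal (A * (t / h) ^ (-b))) t
    + ENNReal.ofReal B

lemma measurable_errorEnvelope {δ₀ h b A B : ℝ} : Measurable (errorEnvelope δ₀ h b A B) := by
  have h1 : Measurable ((Set.Icc 0 δ₀ ∩ Set.Iic h).indicator (1 : ℝ → ℝ≥0∞)) :=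
    measurable_one.indicator (measurableSet_Icc.inter measurableSet_Iic)
  have h2 : Measurable ((Set.Icc 0 δ₀ ∩ Set.Ioi h).indicator
      (fun t => ENNReal.ofReal (A * (t / h) ^ (-b)))) :=
    Measurable.indicator (by fun_prop) (measurableSet_Icc.inter measurableSet_Ioi)
  exact (h1.add h2).add_const _

lemma setLIntegral_withDensity_le_of_le {ρ : ℝ → ℝ} {ρ₀ : ℝ} {S : Set ℝ} (hS : MeasurableSet S)
    (hρ : ∀ t ∈ S, ρ t ≤ ρ₀) (f : ℝ → ℝ≥0∞) :
    ∫⁻ t in S, f t ∂(volume.withDensity fun t => ENNReal.ofReal (ρ t))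
      ≤ ENNReal.ofReal ρ₀ * ∫⁻ t in S, f t := by
  have hle : (volume.withDensity fun t => ENNReal.ofReal (ρ t)).restrict S
      ≤ ENNReal.ofReal ρ₀ • volume.restrict S := by
    refine Measure.le_iff.mpr fun T hT => ?_
    rw [Measure.restrict_apply hT, withDensity_apply _ (hT.inter hS), Measure.smul_apply,
      Measure.restrict_apply hT, smul_eq_mul, ← setLIntegral_const]
    exact setLIntegral_mono' (hT.inter hS) fun t ht => ENNReal.ofReal_le_ofReal (hρ t ht.2)
  calc _ ≤ ∫⁻ t, f t ∂(ENNReal.ofReal ρ₀ • volume.restrict S) := lintegral_mono' hle le_rfl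
    _ = _ := by rw [lintegral_smul_measure, smul_eq_mul]

lemma setLIntegral_Ioi_ofReal_rpow {h b A : ℝ} (hh : 0 < h) (hb : 1 < b) (hA : 0 ≤ A) :
    ∫⁻ t in Set.Ioi h, ENNReal.ofReal (A * (t / h) ^ (-b))
      = ENNReal.ofReal (A * (h / (b - 1))) := by
  have hcongr : ∀ t ∈ Set.Ioi h, A * (t / h) ^ (-b) = A * h ^ b * t ^ (-b) := by
    intro t ht
    have ht0 : 0 < t := hh.trans ht
    rw [Real.div_rpow ht0.le hh.le, Real.rpow_neg hh.le]
    field_simp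
  rw [setLIntegral_congr_fun measurableSet_Ioi fun t ht => congrArg ENNReal.ofReal (hcongr t ht),
    ← ofReal_integral_eq_lintegral_ofReal
      ((integrableOn_Ioi_rpow_of_lt (by linarith) hh).const_mul _), integral_const_mul,
    integral_Ioi_rpow_of_lt (by linarith) hh]
  · congr 1
    have hsplit : h ^ (-b + 1) = h / h ^ b := by
      rw [Real.rpow_add hh, Real.rpow_neg hh.le, Real.rpow_one]; field_simp
    have hb1 : b - 1 ≠ 0 := by linarith
    have hb2 : -b + 1 = -(b - 1) := by ring
    have hhb : 0 < h ^ b := by positivity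
    rw [hsplit, hb2, neg_div_neg_eq]
    field_simp
  · filter_upwards [ae_restrict_mem measurableSet_Ioi] with t ht
    have ht0 : 0 < t := hh.trans ht
    simp only [Pi.zero_apply]
    positivity

lemma lintegral_errorEnvelope_le {lam : Measure ℝ} [IsProbabilityMeasure lam]
    {ρ : ℝ → ℝ} {ρ₀ δ₀ h b A B : ℝ} (hρ₀ : 0 ≤ ρ₀)
    (hlam : lam = volume.withDensity fun t => ENNReal.ofReal (ρ t))
    (hρ : ∀ t ∈ Set.Icc 0 δ₀, ρ t ≤ ρ₀) (hh : 0 < h) (hb : 1 < b) (hA : 0 ≤ A) (hB : 0 ≤ B) :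
    ∫⁻ t, errorEnvelope δ₀ h b A B t ∂lam
      ≤ ENNReal.ofReal (ρ₀ * h + ρ₀ * (A * (h / (b - 1))) + B) := by
  have hS1 : MeasurableSet (Set.Icc 0 δ₀ ∩ Set.Iic h) := measurableSet_Icc.inter measurableSet_Iic
  have hS2 : MeasurableSet (Set.Icc 0 δ₀ ∩ Set.Ioi h) := measurableSet_Icc.inter measurableSet_Ioi
  have hb1 : 0 < b - 1 := by linarith
  unfold errorEnvelope
  rw [lintegral_add_right _ measurable_const, lintegral_add_left (measurable_one.indicator hS1),
    lintegral_indicator hS1, lintegral_indicator hS2, lintegral_const, measure_univ, mul_one,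
    ENNReal.ofReal_add (by positivity) hB, ENNReal.ofReal_add (by positivity) (by positivity),
    ENNReal.ofReal_mul hρ₀, ENNReal.ofReal_mul hρ₀, hlam]
  gcongr
  · refine (setLIntegral_withDensity_le_of_le hS1 (fun t ht => hρ t ht.1) _).trans ?_
    gcongr
    calc ∫⁻ t in Set.Icc 0 δ₀ ∩ Set.Iic h, (1 : ℝ → ℝ≥0∞) t
        = volume (Set.Icc 0 δ₀ ∩ Set.Iic h) := by simp
      _ ≤ volume (Set.Icc 0 h) := measure_mono fun t ht => ⟨ht.1.1, ht.2⟩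
      _ = ENNReal.ofReal h := by simp
  · refine (setLIntegral_withDensity_le_of_le hS2 (fun t ht => hρ t ht.1) _).trans ?_
    gcongr
    rw [← setLIntegral_Ioi_ofReal_rpow hh hb hA]
    exact lintegral_mono_set Set.inter_subset_right

end Envelope

lemma measurable_heaviside : Measurable heaviside :=
  Measurable.ite measurableSet_Ici measurable_const measurable_const

lemma sq_heaviside_sub_le_one (x y : ℝ) : (heaviside x - heaviside y) ^ 2 ≤ 1 := by
  unfold heaviside
  split_ifs <;> norm_num

lemma heaviside_eq_of_abs_sub_lt {x y : ℝ} (h : |x - y| < |y|) : heaviside x = heaviside y := by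
  have hsign : 0 ≤ x ↔ 0 ≤ y := by
    rcases le_or_gt 0 y with hy | hy
    · rw [abs_of_nonneg hy, abs_lt] at h
      exact ⟨fun _ => hy, fun _ => by linarith⟩
    · rw [abs_of_neg hy, abs_lt] at h
      exact ⟨fun _ => by linarith, fun _ => by linarith⟩
  simp only [heaviside, hsign]

lemma lintegral_sq_heaviside_sub_le {P : Measure (ℕ → ℝ)} {n : ℕ} (hn : 1 ≤ n) (m : ℝ) :
    ∫⁻ ω, ENNReal.ofReal ((heaviside ((∑ i ∈ Finset.range n, ω i) / n) - heaviside m) ^ 2) ∂P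
      ≤ P {ω | n * |m| ≤ |∑ i ∈ Finset.range n, ω i - n * m|} := by
  have hn0 : (0 : ℝ) < n := by exact_mod_cast hn
  have hE : MeasurableSet {ω : ℕ → ℝ | n * |m| ≤ |∑ i ∈ Finset.range n, ω i - n * m|} :=
    measurableSet_le measurable_const (by fun_prop)
  rw [← lintegral_indicator_one hE]
  refine lintegral_mono fun ω => ?_
  by_cases hω : n * |m| ≤ |∑ i ∈ Finset.range n, ω i - n * m|
  · rw [Set.indicator_of_mem (by exact hω), Pi.one_apply, ← ENNReal.ofReal_one]
    exact ENNReal.ofReal_le_ofReal (sq_heaviside_sub_le_one _ _)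
  · have hlt : |(∑ i ∈ Finset.range n, ω i) / n - m| < |m| := by
      rw [show (∑ i ∈ Finset.range n, ω i) / n - m
          = (∑ i ∈ Finset.range n, ω i - n * m) / n by field_simp,
        abs_div, abs_of_pos hn0, div_lt_iff₀ hn0]
      linarith [not_le.mp hω]
    simp [heaviside_eq_of_abs_sub_lt hlt]

/-- Variance of perfect adaptive sampling: let `q > 2` and
`1 < r < 2 − 2/q`, and assume the bounded-density assumption on `δ = d/σ` and the
bounded-moment assumption `κ_q < ∞`.  The conditionally i.i.d. inner samples are modelled
by a Markov kernel `ξ` into sequence space whose finite-dimensional marginals are products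
of `μ y`.  If for each level `ℓ` the (measurable) number of samples `N_ℓ`, a function of
`Y` through `δ`, satisfies `fN_ℓ(δ) ≤ N_ℓ < 2·fN_ℓ(δ)`, then there is a constant `c`,
independent of `ℓ`, with `Var(H(Ê_{N_ℓ}(Y)) − H(E[X|Y])) ≤ c·2^{-ℓ}` for all `ℓ`. -/
theorem variance_perfect_adaptive {𝓨 : Type*} [MeasurableSpace 𝓨]
    (ν : Measure 𝓨) [IsProbabilityMeasure ν]
    (μ : 𝓨 → Measure ℝ) (hprob : ∀ y, IsProbabilityMeasure (μ y))
    (m s δ : 𝓨 → ℝ)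
    (hm : ∀ y, m y = ∫ t, t ∂μ y)
    (hs : ∀ y, s y = Real.sqrt (variance (fun t => t) (μ y)))
    (hδ : ∀ y, δ y = |m y| / s y)
    (hmmeas : Measurable m) (hδmeas : Measurable δ)
    (ρ : ℝ → ℝ) (ρ₀ δ₀ : ℝ) (hρ₀ : 0 < ρ₀) (hδ₀ : 0 < δ₀)
    (hdensity : ν.map δ = MeasureTheory.volume.withDensity fun t => ENNReal.ofReal (ρ t))
    (hρbound : ∀ t ∈ Set.Icc (0 : ℝ) δ₀, ρ t ≤ ρ₀)
    (q : ℝ) (hq : 2 < q) (κq : ℝ)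
    (hmom : ∀ y, Integrable (fun x => |x - m y| ^ q) (μ y))
    (hκq : ∀ y, (∫ x, |x - m y| ^ q ∂μ y) ≤ κq * s y ^ q)
    (r : ℝ) (hr1 : 1 < r) (hr2 : r < 2 - 2 / q)
    (N₀ : ℕ) (hN₀ : 1 ≤ N₀) (C : ℝ) (hC : 1 ≤ C)
    (ξ : Kernel 𝓨 (ℕ → ℝ)) [IsMarkovKernel ξ]
    (hiid : ∀ y (n : ℕ),
      (ξ y).map (fun ω (i : Fin n) => ω i) = Measure.pi fun _ : Fin n => μ y) :
    ∃ c : ℝ, ∀ (ℓ : ℕ) (Nl : ℝ → ℕ), Measurable Nl →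
      (∀ t : ℝ, 0 ≤ t →
        adaptiveTarget N₀ C r ℓ t ≤ (Nl t : ℝ≥0∞) ∧
        (Nl t : ℝ≥0∞) < 2 * adaptiveTarget N₀ C r ℓ t) →
      variance
          (fun p : 𝓨 × (ℕ → ℝ) =>
            heaviside ((∑ i ∈ Finset.range (Nl (δ p.1)), p.2 i) / (Nl (δ p.1) : ℝ))
              - heaviside (m p.1)) (ν ⊗ₘ ξ)
        ≤ c * (2 : ℝ) ^ (-(ℓ : ℝ)) := by
  have hq0 : 0 < q / 2 := by linarith
  set b : ℝ := (2 - r) * (q / 2) with hbdef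
  have hb : 1 < b := by
    have h1 : 2 / q < 2 - r := by linarith
    calc (1 : ℝ) = 2 / q * (q / 2) := by field_simp
      _ < b := mul_lt_mul_of_pos_right h1 hq0
  set K : ℝ := max 1 (rpowTaylorConst q * (2 + κq))
  have hK1 : 1 ≤ K := le_max_left _ _
  set A : ℝ := (2 * K) ^ (q / 2)
  have hA0 : 0 ≤ A := by positivity
  set h₁ : ℝ := C / (N₀ : ℝ) ^ ((1 : ℝ) / 2)
  refine ⟨ρ₀ * h₁ + ρ₀ * (A * (h₁ / (b - 1))) + A * (δ₀ ^ 2) ^ (-(q / 2)),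
    fun ℓ Nl hNl hbounds => ?_⟩
  set h : ℝ := adaptiveScale N₀ C ℓ
  have hh0 : 0 < h := adaptiveScale_pos hN₀ hC
  set B : ℝ := A * (δ₀ ^ 2) ^ (-(q / 2)) * ((2 : ℝ) ^ ℓ)⁻¹ with hBdef
  have hB0 : 0 ≤ B := by positivity
  have hδ0 : ∀ y, 0 ≤ δ y := fun y => by
    rw [hδ, hs]; positivity
  have hN1 : ∀ y, 1 ≤ Nl (δ y) := fun y => by
    have h1 := two_pow_le_of_adaptiveTarget_le hN₀ (hbounds _ (hδ0 y)).1
    have h2 : (1 : ℝ) ≤ 2 ^ ℓ := one_le_pow₀ (by norm_num)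
    exact_mod_cast h2.trans h1
  have hcond : ∀ y, ∫⁻ ω, ENNReal.ofReal ((heaviside ((∑ i ∈ Finset.range (Nl (δ y)), ω i)
      / (Nl (δ y) : ℝ)) - heaviside (m y)) ^ 2) ∂ξ y ≤ errorEnvelope δ₀ h b A B (δ y) := by
    intro y
    have := hprob y
    refine (lintegral_sq_heaviside_sub_le (hN1 y) (m y)).trans ?_
    have htail : 0 < δ y → ξ y {ω | (Nl (δ y) : ℝ) * |m y|
        ≤ |∑ i ∈ Finset.range (Nl (δ y)), ω i - Nl (δ y) * m y|}
          ≤ ENNReal.ofReal (A * (Nl (δ y) * δ y ^ 2) ^ (-(q / 2))) := by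
      intro hpos
      have hs0 : 0 < s y := by
        refine lt_of_le_of_ne (by rw [hs]; positivity) fun h0 => ?_
        rw [hδ, ← h0, div_zero] at hpos
        exact lt_irrefl _ hpos
      have hms : |m y| = δ y * s y := by rw [hδ]; field_simp
      rw [hms]
      exact measure_le_abs_sum_sub_le (hiid y) (hm y) (hs y) hs0 hq.le (hmom y) (hκq y)
        hK1 (le_max_right _ _) (hN1 y) hpos
    have htarget := (hbounds _ (hδ0 y)).1
    unfold errorEnvelope
    rcases le_or_gt (δ y) δ₀ with hle | hgt
    · refine le_trans ?_ le_self_add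
      rcases le_or_gt (δ y) h with hsmall | hlarge
      · refine le_trans ?_ le_self_add
        rw [Set.indicator_of_mem (Set.mem_inter (Set.mem_Icc.mpr ⟨hδ0 y, hle⟩) (Set.mem_Iic.mpr hsmall))]
        exact prob_le_one
      · refine le_trans ?_ le_add_self
        rw [Set.indicator_of_mem (Set.mem_inter (Set.mem_Icc.mpr ⟨hδ0 y, hle⟩) (Set.mem_Ioi.mpr hlarge))]
        refine (htail (hh0.trans hlarge)).trans (ENNReal.ofReal_le_ofReal ?_)
        have hscaled : 0 < δ y / h := div_pos (hh0.trans hlarge) hh0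
        rw [hbdef, ← mul_neg, Real.rpow_mul hscaled.le]
        refine mul_le_mul_of_nonneg_left ?_ hA0
        exact Real.rpow_le_rpow_of_nonpos (by positivity)
          (rpow_le_of_adaptiveTarget_le hN₀ hC (by linarith) hlarge htarget) (by linarith)
    · refine le_trans ?_ le_add_self
      refine (htail (hδ₀.trans hgt)).trans (ENNReal.ofReal_le_ofReal ?_)
      rw [hBdef, mul_assoc]
      refine mul_le_mul_of_nonneg_left ?_ hA0
      have hpow1 : (1 : ℝ) ≤ 2 ^ ℓ := one_le_pow₀ (by norm_num)
      calc ((Nl (δ y) : ℝ) * δ y ^ 2) ^ (-(q / 2)) ≤ (2 ^ ℓ * δ₀ ^ 2) ^ (-(q / 2)) := by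
            refine Real.rpow_le_rpow_of_nonpos (by positivity) ?_ (by linarith)
            gcongr
            exact two_pow_le_of_adaptiveTarget_le hN₀ htarget
        _ = (δ₀ ^ 2) ^ (-(q / 2)) * ((2 : ℝ) ^ ℓ) ^ (-(q / 2)) := by
            rw [Real.mul_rpow (by positivity) (by positivity), mul_comm]
        _ ≤ (δ₀ ^ 2) ^ (-(q / 2)) * ((2 : ℝ) ^ ℓ) ^ (-1 : ℝ) := by
            gcongr
            linarith
        _ = _ := by rw [Real.rpow_neg_one]
  have hmeas : Measurable fun p : 𝓨 × (ℕ → ℝ) =>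
      heaviside ((∑ i ∈ Finset.range (Nl (δ p.1)), p.2 i) / (Nl (δ p.1) : ℝ))
        - heaviside (m p.1) := by
    have hfixed : Measurable fun z : (𝓨 × (ℕ → ℝ)) × ℕ =>
        (∑ i ∈ Finset.range z.2, z.1.2 i) / (z.2 : ℝ) :=
      measurable_from_prod_countable_left fun n => by
        dsimp only
        fun_prop
    exact (measurable_heaviside.comp (hfixed.comp
      (measurable_id.prodMk (hNl.comp (hδmeas.comp measurable_fst))))).sub
      (measurable_heaviside.comp (hmmeas.comp measurable_fst))
  have := Measure.isProbabilityMeasure_map (μ := ν) hδmeas.aemeasurable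
  refine (variance_le_expectation_sq hmeas.aestronglyMeasurable).trans ?_
  rw [integral_eq_lintegral_of_nonneg_ae (ae_of_all _ fun p => by exact sq_nonneg _)
    (by exact (hmeas.pow_const 2).aestronglyMeasurable)]
  have hb1 : 0 < b - 1 := by linarith
  refine ENNReal.toReal_le_of_le_ofReal (by positivity) ?_
  calc ∫⁻ p, ENNReal.ofReal (((fun p : 𝓨 × (ℕ → ℝ) =>
          heaviside ((∑ i ∈ Finset.range (Nl (δ p.1)), p.2 i) / (Nl (δ p.1) : ℝ))
            - heaviside (m p.1)) ^ 2) p) ∂(ν ⊗ₘ ξ)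
      = ∫⁻ y, ∫⁻ ω, ENNReal.ofReal ((heaviside ((∑ i ∈ Finset.range (Nl (δ y)), ω i)
          / (Nl (δ y) : ℝ)) - heaviside (m y)) ^ 2) ∂ξ y ∂ν :=
        Measure.lintegral_compProd (hmeas.pow_const 2).ennreal_ofReal
    _ ≤ ∫⁻ y, errorEnvelope δ₀ h b A B (δ y) ∂ν := lintegral_mono hcond
    _ = ∫⁻ t, errorEnvelope δ₀ h b A B t ∂ν.map δ :=
        (lintegral_map measurable_errorEnvelope hδmeas).symm
    _ ≤ ENNReal.ofReal (ρ₀ * h + ρ₀ * (A * (h / (b - 1))) + B) :=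
        lintegral_errorEnvelope_le hρ₀.le hdensity hρbound hh0 hb hA0 hB0
    _ = _ := by
        have hscale : h = h₁ * ((2 : ℝ) ^ ℓ)⁻¹ := rfl
        rw [Real.rpow_neg zero_le_two, Real.rpow_natCast, hscale, hBdef]
        congr 1
        ring
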